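/- Fix real numbers p01, p11 with 0 ≤ p11 < p01 ≤ 1 and a belief vector ω = (ω1, ω2, ω3) with 1 ≥ ω1 ≥ ω2 ≥ ω3 ≥ 0 (so N = 3 channels). Then for every two-slot sense-two policy (every choice of a first-slot pair {a,b} of distinct indices in {1,2,3} and of observation-dependent second-slot pairs {c_s,d_s}), the expected two-slot reward V satisfies V ≤ R*₋, where R*₋ = [1 − (1−ω1)(1−ω2)] + ω1ω2[1 − (1−p11)(1−τ(ω3))] + [ω1(1−ω2) + (1−ω1)ω2]·[1 − (1−p01)(1−τ(ω3))] + (1−ω1)(1−ω2)[1 − (1−p01)²]. (R*₋ is the expected two-slot reward of the myopic policy; hence the myopic sensing policy is optimal for T = 2, k = 2, N = 3 when p11 < p01.) -/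

import Mathlib

/-- Belief update operator `τ(ω) = ω·p11 + (1−ω)·p01`. -/
noncomputable def tau (p01 p11 w : ℝ) : ℝ := w * p11 + (1 - w) * p01

/-- Updated belief after sensing channels `a`,`b` with observation outcome
`s : Bool × Bool` (`true` = idle, `false` = busy). -/
noncomputable def nu (p01 p11 : ℝ) {N : ℕ} (ω : Fin N → ℝ) (a b : Fin N)
    (s : Bool × Bool) (i : Fin N) : ℝ :=
  if i = a then (if s.1 then p11 else p01)
  else if i = b then (if s.2 then p11 else p01)
  else tau p01 p11 (ω i)

/-- Probability of observation outcome `s` when sensing channels `a`,`b`. -/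
noncomputable def outcomeProb {N : ℕ} (ω : Fin N → ℝ) (a b : Fin N)
    (s : Bool × Bool) : ℝ :=
  (if s.1 then ω a else 1 - ω a) * (if s.2 then ω b else 1 - ω b)

/-- Expected two-slot reward of the policy sensing `{a,b}` in the first slot and,
after outcome `s`, the pair `{c s, d s}` in the second slot. -/
noncomputable def policyReward (p01 p11 : ℝ) {N : ℕ} (ω : Fin N → ℝ) (a b : Fin N)
    (c d : (Bool × Bool) → Fin N) : ℝ :=
  (1 - (1 - ω a) * (1 - ω b)) +
    ∑ s : Bool × Bool,
      outcomeProb ω a b s *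
        (1 - (1 - nu p01 p11 ω a b s (c s)) * (1 - nu p01 p11 ω a b s (d s)))

/-- Two-slot reward of sensing channels with beliefs `x`, `y` first and then the two channels with
the largest updated beliefs, when the third channel has belief `z` and `p11 ≤ p01`. -/
noncomputable def greedyReward (p01 p11 x y z : ℝ) : ℝ :=
  (1 - (1 - x) * (1 - y))
  + x * y * (1 - (1 - p11) * (1 - tau p01 p11 z))
  + (x * (1 - y) + (1 - x) * y) * (1 - (1 - p01) * (1 - tau p01 p11 z))
  + (1 - x) * (1 - y) * (1 - (1 - p01) * (1 - p01))

theorem greedyReward_comm (p01 p11 x y z : ℝ) :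
    greedyReward p01 p11 x y z = greedyReward p01 p11 y x z := by
  unfold greedyReward; ring

theorem greedyReward_sub_swap (p01 p11 x y z : ℝ) :
    greedyReward p01 p11 x y z - greedyReward p01 p11 x z y = (1 - x) * (y - z) := by
  unfold greedyReward tau; ring

theorem greedyReward_swap_le (p01 p11 : ℝ) {x y z : ℝ} (hx : x ≤ 1) (hzy : z ≤ y) :
    greedyReward p01 p11 x z y ≤ greedyReward p01 p11 x y z := by
  have := greedyReward_sub_swap p01 p11 x y z
  have := mul_nonneg (sub_nonneg.2 hx) (sub_nonneg.2 hzy)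
  linarith

theorem le_tau {p01 p11 w : ℝ} (h : p11 ≤ p01) (hw : w ≤ 1) : p11 ≤ tau p01 p11 w := by
  unfold tau; nlinarith [mul_nonneg (sub_nonneg.2 h) (sub_nonneg.2 hw)]

theorem tau_le {p01 p11 w : ℝ} (h : p11 ≤ p01) (hw : 0 ≤ w) : tau p01 p11 w ≤ p01 := by
  unfold tau; nlinarith [mul_nonneg (sub_nonneg.2 h) hw]

/-- Sensing two of three channels earns at most what sensing the two with beliefs `u i`, `u j`
earns, when the remaining channel `k` has the smallest belief. -/
theorem pair_reward_le {u : Fin 3 → ℝ} (hu : ∀ i, u i ≤ 1) {i j k : Fin 3}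
    (hij : i ≠ j) (hik : i ≠ k) (hjk : j ≠ k) (hi : u k ≤ u i) (hj : u k ≤ u j)
    {c d : Fin 3} (hcd : c ≠ d) :
    1 - (1 - u c) * (1 - u d) ≤ 1 - (1 - u i) * (1 - u j) := by
  have hc : c = i ∨ c = j ∨ c = k := by omega
  have hd : d = i ∨ d = j ∨ d = k := by omega
  have h₁ := mul_nonneg (sub_nonneg.2 (hu i)) (sub_nonneg.2 hj)
  have h₂ := mul_nonneg (sub_nonneg.2 (hu j)) (sub_nonneg.2 hi)
  rcases hc with rfl | rfl | rfl <;> rcases hd with rfl | rfl | rfl <;>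
    first
      | exact absurd rfl hcd
      | nlinarith

theorem policyReward_le_greedyReward {p01 p11 : ℝ} (hp : p11 ≤ p01) (hp1 : p01 ≤ 1)
    {ω : Fin 3 → ℝ} (h0 : ∀ i, 0 ≤ ω i) (h1 : ∀ i, ω i ≤ 1) {a b e : Fin 3}
    (hab : a ≠ b) (hae : a ≠ e) (hbe : b ≠ e)
    {c d : (Bool × Bool) → Fin 3} (hcd : ∀ s, c s ≠ d s) :
    policyReward p01 p11 ω a b c d ≤ greedyReward p01 p11 (ω a) (ω b) (ω e) := by
  have hl := le_tau hp (h1 e)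
  have hr := tau_le hp (h0 e)
  have hν : ∀ s i, nu p01 p11 ω a b s i ≤ 1 := by
    intro s i
    have := tau_le hp (h0 i)
    unfold nu
    split_ifs <;> linarith
  have hP : ∀ s, 0 ≤ outcomeProb ω a b s := by
    intro s
    have := h0 a; have := h0 b; have := h1 a; have := h1 b
    unfold outcomeProb
    apply mul_nonneg <;> split_ifs <;> linarith
  have νa : ∀ s, nu p01 p11 ω a b s a = if s.1 then p11 else p01 := fun s => by simp [nu]
  have νb : ∀ s, nu p01 p11 ω a b s b = if s.2 then p11 else p01 := fun s => by
    simp [nu, hab.symm]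
  have νe : ∀ s, nu p01 p11 ω a b s e = tau p01 p11 (ω e) := fun s => by
    simp [nu, hae.symm, hbe.symm]
  have htt := mul_le_mul_of_nonneg_left (pair_reward_le (hν (true, true)) hae hab hbe.symm
    (by simp [νa, νb]) (by simpa [νe, νb] using hl) (hcd (true, true))) (hP (true, true))
  have htf := mul_le_mul_of_nonneg_left (pair_reward_le (hν (true, false)) hbe hab.symm hae.symm
    (by simpa [νa, νb] using hp) (by simpa [νe, νa] using hl) (hcd (true, false)))
    (hP (true, false))
  have hft := mul_le_mul_of_nonneg_left (pair_reward_le (hν (false, true)) hae hab hbe.symm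
    (by simpa [νa, νb] using hp) (by simpa [νe, νb] using hl) (hcd (false, true)))
    (hP (false, true))
  have hff := mul_le_mul_of_nonneg_left (pair_reward_le (hν (false, false)) hab hae hbe
    (by simpa [νa, νe] using hr) (by simpa [νe, νb] using hr) (hcd (false, false)))
    (hP (false, false))
  rw [νa, νe] at htt hft
  rw [νb, νe] at htf
  rw [νa, νb] at hff
  rw [policyReward, Fintype.sum_prod_type, greedyReward]
  simp only [Fintype.sum_bool]
  refine (add_le_add_right (add_le_add (add_le_add htt htf) (add_le_add hft hff)) _).trans_eq ?_
  simp only [outcomeProb, if_true, Bool.false_eq_true, if_false]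
  ring

/-- Optimality of the myopic sensing policy for `T = 2`, `k = 2`, `N = 3` when
`p11 < p01`: every two-slot sense-two policy earns at most the myopic reward `R*₋`. -/
theorem myopic_optimal_T2_k2_neg_N3 (p01 p11 : ℝ)
    (hp0 : 0 ≤ p11) (hp1 : p11 < p01) (hp2 : p01 ≤ 1)
    (ω : Fin 3 → ℝ)
    (hub : ω 0 ≤ 1) (h01 : ω 1 ≤ ω 0) (h12 : ω 2 ≤ ω 1) (hlb : 0 ≤ ω 2)
    (a b : Fin 3) (hab : a ≠ b)
    (c d : (Bool × Bool) → Fin 3) (hcd : ∀ s, c s ≠ d s) :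
    policyReward p01 p11 ω a b c d ≤
      (1 - (1 - ω 0) * (1 - ω 1))
      + ω 0 * ω 1 * (1 - (1 - p11) * (1 - tau p01 p11 (ω 2)))
      + (ω 0 * (1 - ω 1) + (1 - ω 0) * ω 1) *
          (1 - (1 - p01) * (1 - tau p01 p11 (ω 2)))
      + (1 - ω 0) * (1 - ω 1) * (1 - (1 - p01) * (1 - p01)) := by
  change _ ≤ greedyReward p01 p11 (ω 0) (ω 1) (ω 2)
  have h0 : ∀ i, 0 ≤ ω i := by
    intro i; fin_cases i <;> simp <;> linarith
  have h1 : ∀ i, ω i ≤ 1 := by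
    intro i; fin_cases i <;> simp <;> linarith
  have key : ∀ e : Fin 3, a ≠ e → b ≠ e →
      policyReward p01 p11 ω a b c d ≤ greedyReward p01 p11 (ω a) (ω b) (ω e) :=
    fun e hae hbe => policyReward_le_greedyReward hp1.le hp2 h0 h1 hab hae hbe hcd
  have h02 : greedyReward p01 p11 (ω 0) (ω 2) (ω 1) ≤ greedyReward p01 p11 (ω 0) (ω 1) (ω 2) :=
    greedyReward_swap_le p01 p11 hub h12
  have h21 : greedyReward p01 p11 (ω 2) (ω 1) (ω 0) ≤ greedyReward p01 p11 (ω 2) (ω 0) (ω 1) :=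
    greedyReward_swap_le p01 p11 (h1 2) h01
  have h20 := greedyReward_comm p01 p11 (ω 2) (ω 0) (ω 1)
  have h10 := greedyReward_comm p01 p11 (ω 1) (ω 0) (ω 2)
  have h12' := greedyReward_comm p01 p11 (ω 1) (ω 2) (ω 0)
  have ha : a = 0 ∨ a = 1 ∨ a = 2 := by omega
  have hb : b = 0 ∨ b = 1 ∨ b = 2 := by omega
  rcases ha with rfl | rfl | rfl <;> rcases hb with rfl | rfl | rfl <;>
    first
      | exact absurd rfl hab
      | linarith [key 0 (by decide) (by decide)]
      | linarith [key 1 (by decide) (by decide)]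
      | linarith [key 2 (by decide) (by decide)]
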